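/- arXiv:2604.14853 — 6 statements merged into one kernel-verified Lean document; each statement's English description precedes it below -/
import Mathlib

section
/- For every input i ∈ Fin N and all real numbers λ ≤ λ', the oracle allocation satisfies C(b⋆(i; λ')) ≤ C(b⋆(i; λ)); that is, for each input the cost of the oracle budget is a non-increasing function of the dual variable λ. -/
/-- `b` is the oracle allocation: for every dual variable `lam` and input `i`,
`b lam i` maximizes `k ↦ Acc i k - lam * C k`, with ties broken first in favor of
smaller cost `C k` and then in favor of smaller index `k`. -/
def IsOracle {N K : ℕ} (C : Fin K → ℝ) (Acc : Fin N → Fin K → ℝ)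
    (b : ℝ → Fin N → Fin K) : Prop :=
  ∀ (lam : ℝ) (i : Fin N) (k : Fin K),
    (Acc i k - lam * C k ≤ Acc i (b lam i) - lam * C (b lam i)) ∧
    (Acc i k - lam * C k = Acc i (b lam i) - lam * C (b lam i) → C (b lam i) ≤ C k) ∧
    (Acc i k - lam * C k = Acc i (b lam i) - lam * C (b lam i) → C (b lam i) = C k →
      (b lam i : ℕ) ≤ (k : ℕ))

/-- For every input `i` and all `lam ≤ lam'`, the cost of the oracle budget satisfies
`C (b lam' i) ≤ C (b lam i)`: per-input oracle cost is non-increasing in the dual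
variable. -/
theorem oracle_cost_antitone_per_input {N K : ℕ} (hN : 1 ≤ N) (hK : 1 ≤ K)
    (C : Fin K → ℝ) (Acc : Fin N → Fin K → ℝ)
    (hAcc : ∀ i k, 0 ≤ Acc i k ∧ Acc i k ≤ 1)
    (b : ℝ → Fin N → Fin K) (hb : IsOracle C Acc b) :
    ∀ (i : Fin N) (lam lam' : ℝ), lam ≤ lam' → C (b lam' i) ≤ C (b lam i) := by
  intro i lam lam' hl
  rcases hl.eq_or_lt with h | h
  · rw [h]
  · have h1 := (hb lam i (b lam' i)).1
    have h2 := (hb lam' i (b lam i)).1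
    by_contra! hc
    nlinarith [mul_pos (sub_pos.2 h) (sub_pos.2 hc)]
end

section
/- For each input i ∈ Fin N, the set of points λ ∈ ℝ at which the function λ ↦ b⋆(i; λ) is not locally constant is finite, of cardinality at most K(K−1)/2; consequently the average oracle cost C̄ takes only finitely many values and is locally constant outside a finite set of at most N·K(K−1)/2 points. -/
open Filter

/-- The crossover points of input `i`. -/
noncomputable def crossSet {N K : ℕ} (C : Fin K → ℝ) (Acc : Fin N → Fin K → ℝ) (i : Fin N) :
    Finset ℝ :=
  ((Finset.univ : Finset (Fin K)).sigma fun k => Finset.Iio k).image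
    fun p => (Acc i p.1 - Acc i p.2) / (C p.1 - C p.2)

lemma crossSet_card {N K : ℕ} (C : Fin K → ℝ) (Acc : Fin N → Fin K → ℝ) (i : Fin N) :
    (crossSet C Acc i).card ≤ K * (K - 1) / 2 := by
  refine Finset.card_image_le.trans ?_
  rw [Finset.card_sigma]
  simp only [Fin.card_Iio]
  rw [Fin.sum_univ_eq_sum_range (fun k => k) K, Finset.sum_range_id]

lemma mem_crossSet {N K : ℕ} (C : Fin K → ℝ) (Acc : Fin N → Fin K → ℝ) (i : Fin N)
    (lam : ℝ) (k l : Fin K) (hC : C k ≠ C l)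
    (h : Acc i k - lam * C k = Acc i l - lam * C l) : lam ∈ crossSet C Acc i := by
  have hkl : k ≠ l := fun e => hC (by rw [e])
  have h1 : C k - C l ≠ 0 := sub_ne_zero.2 hC
  have h2 : C l - C k ≠ 0 := sub_ne_zero.2 hC.symm
  unfold crossSet
  rw [Finset.mem_image]
  rcases lt_or_gt_of_ne hkl with hlt | hlt
  · refine ⟨⟨l, k⟩, by simp [hlt], ?_⟩
    simp only
    rw [div_eq_iff h2]; linarith
  · refine ⟨⟨k, l⟩, by simp [hlt], ?_⟩
    simp only
    rw [div_eq_iff h1]; linarith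

lemma oracle_eventually {N K : ℕ} (C : Fin K → ℝ) (Acc : Fin N → Fin K → ℝ)
    (b : ℝ → Fin N → Fin K) (hb : IsOracle C Acc b) (i : Fin N) (lam : ℝ)
    (hl : lam ∉ crossSet C Acc i) : ∀ᶠ mu in nhds lam, b mu i = b lam i := by
  have key : ∀ k : Fin K, ∀ᶠ mu in nhds lam, b mu i = k → k = b lam i := by
    intro k
    obtain ⟨h1, h2, h3⟩ := hb lam i k
    by_cases hC : C k = C (b lam i)
    · refine Eventually.of_forall fun mu hmu => ?_
      obtain ⟨g1, g2, g3⟩ := hb mu i (b lam i)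
      rw [hmu] at g1 g2 g3
      rw [hC] at h1 h3 g1 g3
      have e : Acc i k = Acc i (b lam i) := by linarith
      rw [e] at h3 g3
      exact Fin.ext (le_antisymm (g3 rfl rfl) (h3 rfl rfl))
    · have hlt : Acc i k - lam * C k < Acc i (b lam i) - lam * C (b lam i) :=
        lt_of_le_of_ne h1 fun e => hl (mem_crossSet C Acc i lam _ _ hC e)
      have c1 : Continuous fun mu : ℝ => Acc i k - mu * C k := by fun_prop
      have c2 : Continuous fun mu : ℝ => Acc i (b lam i) - mu * C (b lam i) := by fun_prop
      filter_upwards [c1.continuousAt.eventually_lt c2.continuousAt hlt] with mu hmu hk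
      have g1 := (hb mu i (b lam i)).1
      rw [hk] at g1
      exact absurd g1 (not_le.2 hmu)
  filter_upwards [eventually_all.2 key] with mu hmu
  exact hmu _ rfl

/-- For each input `i`, the set of points `lam` at which `lam ↦ b lam i` is not
locally constant is finite of cardinality at most `K (K - 1) / 2`; consequently the
average oracle cost `C̄` takes only finitely many values and is locally constant
outside a finite set of at most `N * K * (K - 1) / 2` points. -/
theorem oracle_locally_constant_outside_finite {N K : ℕ} (hN : 1 ≤ N) (hK : 1 ≤ K)
    (C : Fin K → ℝ) (Acc : Fin N → Fin K → ℝ)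
    (hAcc : ∀ i k, 0 ≤ Acc i k ∧ Acc i k ≤ 1)
    (b : ℝ → Fin N → Fin K) (hb : IsOracle C Acc b) :
    (∀ i : Fin N,
      {lam : ℝ | ¬ ∀ᶠ mu in nhds lam, b mu i = b lam i}.Finite ∧
      {lam : ℝ | ¬ ∀ᶠ mu in nhds lam, b mu i = b lam i}.ncard ≤ K * (K - 1) / 2) ∧
    (Set.range (fun lam : ℝ => (N : ℝ)⁻¹ * ∑ i, C (b lam i))).Finite ∧
    (∃ T : Set ℝ, T.Finite ∧ T.ncard ≤ N * (K * (K - 1) / 2) ∧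
      ∀ lam ∉ T, ∀ᶠ mu in nhds lam,
        (N : ℝ)⁻¹ * ∑ i, C (b mu i) = (N : ℝ)⁻¹ * ∑ i, C (b lam i)) := by
  refine ⟨fun i => ?_, ?_, ?_⟩
  · have hsub : {lam : ℝ | ¬ ∀ᶠ mu in nhds lam, b mu i = b lam i} ⊆ ↑(crossSet C Acc i) := by
      intro lam hlam
      by_contra hn
      exact hlam (oracle_eventually C Acc b hb i lam (by simpa using hn))
    refine ⟨(Finset.finite_toSet _).subset hsub, ?_⟩
    refine (Set.ncard_le_ncard hsub (Finset.finite_toSet _)).trans ?_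
    rw [Set.ncard_coe_finset]
    exact crossSet_card C Acc i
  · refine (Set.finite_range (fun g : Fin N → Fin K => (N : ℝ)⁻¹ * ∑ i, C (g i))).subset ?_
    rintro _ ⟨lam, rfl⟩
    exact ⟨b lam, rfl⟩
  · refine ⟨↑(Finset.univ.biUnion (crossSet C Acc)), Finset.finite_toSet _, ?_, ?_⟩
    · rw [Set.ncard_coe_finset]
      refine (Finset.card_biUnion_le_card_mul _ _ _
        fun i _ => crossSet_card C Acc i).trans ?_
      simp
    · intro lam hlam
      have h : ∀ i, ∀ᶠ mu in nhds lam, b mu i = b lam i := fun i =>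
        oracle_eventually C Acc b hb i lam fun hm =>
          hlam (Finset.mem_coe.2 (Finset.mem_biUnion.2 ⟨i, Finset.mem_univ i, hm⟩))
      filter_upwards [eventually_all.2 h] with mu hmu
      simp only [hmu]
end

section
/- (Budget targeting equals dual minimization.) If λ* ≥ 0 satisfies C̄(λ*) = B, then λ* minimizes the dual function: G(λ*) ≤ G(λ) for every λ ≥ 0 (indeed for every λ ∈ ℝ). -/
/-- The dual function `G(lam) = (1/N) ∑ i, max_k (Acc i k - lam * C k) + lam * B`. -/
noncomputable def Gdual {N K : ℕ} (hK : 0 < K) (C : Fin K → ℝ)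
    (Acc : Fin N → Fin K → ℝ) (B lam : ℝ) : ℝ :=
  (N : ℝ)⁻¹ * ∑ i, (Finset.univ.sup' ⟨⟨0, hK⟩, Finset.mem_univ _⟩
      (fun k => Acc i k - lam * C k)) + lam * B

/-- Budget targeting equals dual minimization: if `lam* ≥ 0` satisfies
`C̄(lam*) = B`, where `C̄(lam) = (1/N) ∑ i, C (b lam i)` is the average oracle cost,
then `lam*` minimizes the dual function: `G(lam*) ≤ G(lam)` for every `lam`
(in particular for every `lam ≥ 0`). -/
theorem budget_targeting_minimizes_dual {N K : ℕ} (hN : 0 < N) (hK : 0 < K)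
    (C : Fin K → ℝ) (Acc : Fin N → Fin K → ℝ)
    (hAcc : ∀ i k, 0 ≤ Acc i k ∧ Acc i k ≤ 1)
    (B : ℝ)
    (b : ℝ → Fin N → Fin K)
    (hb : ∀ (lam : ℝ) (i : Fin N) (k : Fin K),
      Acc i k - lam * C k ≤ Acc i (b lam i) - lam * C (b lam i))
    (lamStar : ℝ) (hlamStar : 0 ≤ lamStar)
    (hbudget : (N : ℝ)⁻¹ * ∑ i, C (b lamStar i) = B) :
    ∀ lam : ℝ, Gdual hK C Acc B lamStar ≤ Gdual hK C Acc B lam := by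
  intro lam
  unfold Gdual
  have key : ∀ i : Fin N,
      (Finset.univ.sup' ⟨⟨0, hK⟩, Finset.mem_univ _⟩ (fun k => Acc i k - lamStar * C k))
        + lamStar * C (b lamStar i)
      ≤ (Finset.univ.sup' ⟨⟨0, hK⟩, Finset.mem_univ _⟩ (fun k => Acc i k - lam * C k))
        + lam * C (b lamStar i) := by
    intro i
    have h1 : (Finset.univ.sup' ⟨⟨0, hK⟩, Finset.mem_univ _⟩
        (fun k => Acc i k - lamStar * C k))
        ≤ Acc i (b lamStar i) - lamStar * C (b lamStar i) :=
      Finset.sup'_le _ _ (fun k _ => hb lamStar i k)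
    have h2 := Finset.le_sup' (fun k => Acc i k - lam * C k)
      (Finset.mem_univ (b lamStar i))
    linarith
  have hs := Finset.sum_le_sum (fun i (_ : i ∈ Finset.univ) => key i)
  rw [Finset.sum_add_distrib, Finset.sum_add_distrib, ← Finset.mul_sum, ← Finset.mul_sum] at hs
  have hN' : (0 : ℝ) ≤ (N : ℝ)⁻¹ := by positivity
  have hm := mul_le_mul_of_nonneg_left hs hN'
  rw [← hbudget]
  linarith
end

section
/- (Strong duality for the LP relaxation, Proposition 2 in its stochastic-policy form.) Define V̂_LP(B) as the supremum, over stochastic policies p (each p i a probability vector on Fin K) satisfying the budget constraint (1/N)·Σ_i Σ_k (p i k)·C k ≤ B, of the expected accuracy (1/N)·Σ_i Σ_k (p i k)·Acc i k. If min_k C k ≤ B, then V̂_LP(B) = min_{λ ≥ 0} G(λ); moreover both the supremum and the minimum are attained. -/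
/-- A stochastic policy `p` is feasible at budget `B`: each `p i` is a probability
vector over `Fin K` and the expected average cost is at most `B`. -/
noncomputable def FeasLP {N K : ℕ} (C : Fin K → ℝ) (B : ℝ) (p : Fin N → Fin K → ℝ) : Prop :=
  (∀ i k, 0 ≤ p i k) ∧ (∀ i, ∑ k, p i k = 1) ∧
    (N : ℝ)⁻¹ * ∑ i, ∑ k, p i k * C k ≤ B

/-- The expected accuracy of a stochastic policy. -/
noncomputable def ValLP {N K : ℕ} (Acc : Fin N → Fin K → ℝ) (p : Fin N → Fin K → ℝ) : ℝ :=
  (N : ℝ)⁻¹ * ∑ i, ∑ k, p i k * Acc i k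

def OptD {N K : ℕ} (C : Fin K → ℝ) (Acc : Fin N → Fin K → ℝ) (lam : ℝ)
    (d : Fin N → Fin K) : Prop :=
  ∀ i k, Acc i k - lam * C k ≤ Acc i (d i) - lam * C (d i)

lemma OptD.G_eq {N K : ℕ} (hK : 0 < K) {C : Fin K → ℝ} {Acc : Fin N → Fin K → ℝ} {lam : ℝ}
    {d : Fin N → Fin K} (h : OptD C Acc lam d) (B : ℝ) :
    Gdual hK C Acc B lam = (N : ℝ)⁻¹ * ∑ i, Acc i (d i)
      - lam * ((N : ℝ)⁻¹ * ∑ i, C (d i)) + lam * B := by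
  have h1 : ∀ i, (Finset.univ.sup' ⟨⟨0, hK⟩, Finset.mem_univ _⟩
      (fun k => Acc i k - lam * C k)) = Acc i (d i) - lam * C (d i) := by
    intro i
    apply le_antisymm
    · exact Finset.sup'_le _ _ (fun k _ => h i k)
    · exact Finset.le_sup' (fun k => Acc i k - lam * C k) (Finset.mem_univ (d i))
  unfold Gdual
  simp only [h1, Finset.sum_sub_distrib, ← Finset.mul_sum]
  ring

lemma exists_optD {N K : ℕ} (hK : 0 < K) (C : Fin K → ℝ) (Acc : Fin N → Fin K → ℝ) (lam : ℝ) :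
    ∃ d, OptD C Acc lam d := by
  have : ∀ i, ∃ j, ∀ k, Acc i k - lam * C k ≤ Acc i j - lam * C j := by
    intro i
    haveI : Nonempty (Fin K) := ⟨⟨0, hK⟩⟩
    exact Finite.exists_max (fun k => Acc i k - lam * C k)
  choose d hd using this
  exact ⟨d, hd⟩

lemma isClosed_optD {N K : ℕ} (C : Fin K → ℝ) (Acc : Fin N → Fin K → ℝ)
    (P : (Fin N → Fin K) → Prop) :
    IsClosed {lam : ℝ | ∃ d, P d ∧ OptD C Acc lam d} := by
  have : {lam : ℝ | ∃ d, P d ∧ OptD C Acc lam d} =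
      ⋃ d : Fin N → Fin K, {lam : ℝ | P d ∧ OptD C Acc lam d} := by
    ext; simp
  rw [this]
  apply isClosed_iUnion_of_finite
  intro d
  by_cases hP : P d
  · simp only [hP, true_and, OptD, Set.setOf_forall]
    refine isClosed_iInter fun i => isClosed_iInter fun k => ?_
    exact isClosed_le (by fun_prop) (by fun_prop)
  · simp [hP]

lemma large_optD {N K : ℕ} (hN : 0 < N) (hK : 0 < K)
    (C : Fin K → ℝ) (Acc : Fin N → Fin K → ℝ)
    (hAcc : ∀ i k, 0 ≤ Acc i k ∧ Acc i k ≤ 1) (B : ℝ)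
    (hB : Finset.univ.inf' ⟨⟨0, hK⟩, Finset.mem_univ _⟩ C ≤ B) :
    ∃ lam : ℝ, 0 ≤ lam ∧ ∃ d : Fin N → Fin K, (N : ℝ)⁻¹ * ∑ i, C (d i) ≤ B ∧
      OptD C Acc lam d := by
  haveI : Nonempty (Fin K) := ⟨⟨0, hK⟩⟩
  obtain ⟨k0, hk0⟩ := Finite.exists_min C
  have hk0B : C k0 ≤ B := (Finset.le_inf' _ _ (fun k _ => hk0 k)).trans hB
  have : ∀ i, ∃ j, C j = C k0 ∧ ∀ k, C k = C k0 → Acc i k ≤ Acc i j := by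
    intro i
    obtain ⟨j, hj, hm⟩ := Finset.exists_max_image (Finset.univ.filter (fun k => C k = C k0))
      (Acc i) ⟨k0, by simp⟩
    simp only [Finset.mem_filter, Finset.mem_univ, true_and] at hj hm
    exact ⟨j, hj, hm⟩
  choose d hd1 hd2 using this
  have hnn : ∀ k ∈ (Finset.univ : Finset (Fin K)), 0 ≤ (C k - C k0)⁻¹ :=
    fun k _ => inv_nonneg.2 (sub_nonneg.2 (hk0 k))
  refine ⟨∑ k, (C k - C k0)⁻¹, Finset.sum_nonneg hnn, d, ?_, ?_⟩
  · simp only [hd1, Finset.sum_const, Finset.card_univ, Fintype.card_fin, nsmul_eq_mul]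
    have : (N : ℝ) ≠ 0 := by positivity
    rw [inv_mul_cancel_left₀ this]
    exact hk0B
  · intro i k
    rw [hd1 i]
    rcases (hk0 k).eq_or_lt with h | h
    · have := hd2 i k h.symm
      rw [h]; linarith
    · have h1 := Finset.single_le_sum hnn (Finset.mem_univ k)
      have h2 : 0 < C k - C k0 := sub_pos.2 h
      have h3 := mul_le_mul_of_nonneg_right h1 h2.le
      rw [inv_mul_cancel₀ h2.ne'] at h3
      have := (hAcc i k).2
      have := (hAcc i (d i)).1
      linarith

lemma core_pair {N K : ℕ} (hN : 0 < N) (hK : 0 < K)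
    (C : Fin K → ℝ) (Acc : Fin N → Fin K → ℝ)
    (hAcc : ∀ i k, 0 ≤ Acc i k ∧ Acc i k ≤ 1) (B : ℝ)
    (hB : Finset.univ.inf' ⟨⟨0, hK⟩, Finset.mem_univ _⟩ C ≤ B) :
    ∃ lam : ℝ, 0 ≤ lam ∧ ∃ d : Fin N → Fin K, (N : ℝ)⁻¹ * ∑ i, C (d i) ≤ B ∧
      OptD C Acc lam d ∧ (lam = 0 ∨ ∃ d' : Fin N → Fin K, B ≤ (N : ℝ)⁻¹ * ∑ i, C (d' i) ∧
      OptD C Acc lam d') := by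
  set S : Set ℝ := Set.Ici 0 ∩
    {lam : ℝ | ∃ d : Fin N → Fin K, (N : ℝ)⁻¹ * ∑ i, C (d i) ≤ B ∧ OptD C Acc lam d} with hS
  set T : Set ℝ :=
    {lam : ℝ | ∃ d : Fin N → Fin K, B ≤ (N : ℝ)⁻¹ * ∑ i, C (d i) ∧ OptD C Acc lam d} with hT
  have hSc : IsClosed S := isClosed_Ici.inter (isClosed_optD C Acc _)
  have hTc : IsClosed T := isClosed_optD C Acc _
  have hSn : S.Nonempty := by
    obtain ⟨l, h0, h⟩ := large_optD hN hK C Acc hAcc B hB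
    exact ⟨l, h0, h⟩
  have hSb : BddBelow S := ⟨0, fun x hx => hx.1⟩
  have hmem := hSc.csInf_mem hSn hSb
  obtain ⟨h0, d, hd, hod⟩ := hmem
  refine ⟨sInf S, h0, d, hd, hod, ?_⟩
  rcases (show (0:ℝ) ≤ sInf S from h0).eq_or_lt with h | h
  · exact Or.inl h.symm
  · right
    have hsub : Set.Ico 0 (sInf S) ⊆ T := by
      intro l hl
      obtain ⟨e, he⟩ := exists_optD hK C Acc l
      refine ⟨e, ?_, he⟩
      by_contra hc
      have : l ∈ S := ⟨hl.1, e, (not_le.1 hc).le, he⟩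
      exact absurd (csInf_le hSb this) (not_le.2 hl.2)
    have h2 := closure_minimal hsub hTc
    rw [closure_Ico h.ne] at h2
    exact h2 ⟨h.le, le_rfl⟩

lemma core_lp {N K : ℕ} (hN : 0 < N) (hK : 0 < K)
    (C : Fin K → ℝ) (Acc : Fin N → Fin K → ℝ)
    (hAcc : ∀ i k, 0 ≤ Acc i k ∧ Acc i k ≤ 1) (B : ℝ)
    (hB : Finset.univ.inf' ⟨⟨0, hK⟩, Finset.mem_univ _⟩ C ≤ B) :
    ∃ lam : ℝ, 0 ≤ lam ∧ ∃ p : Fin N → Fin K → ℝ, FeasLP C B p ∧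
      Gdual hK C Acc B lam = ValLP Acc p := by
  obtain ⟨lam, h0, d, hd, hod, h⟩ := core_pair hN hK C Acc hAcc B hB
  refine ⟨lam, h0, ?_⟩
  -- reduce to a mixture
  obtain ⟨d', t, ht0, ht1, hod', hc, hs⟩ : ∃ (d' : Fin N → Fin K) (t : ℝ), 0 ≤ t ∧ t ≤ 1 ∧
      OptD C Acc lam d' ∧
      (1 - t) * ((N : ℝ)⁻¹ * ∑ i, C (d i)) + t * ((N : ℝ)⁻¹ * ∑ i, C (d' i)) ≤ B ∧
      lam * ((1 - t) * ((N : ℝ)⁻¹ * ∑ i, C (d i)) + t * ((N : ℝ)⁻¹ * ∑ i, C (d' i)) - B) = 0 := by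
    rcases h with h | ⟨d', hd', hod'⟩
    · exact ⟨d, 0, le_rfl, zero_le_one, hod, by simpa using hd, by simp [h]⟩
    · set a := (N : ℝ)⁻¹ * ∑ i, C (d i)
      set b := (N : ℝ)⁻¹ * ∑ i, C (d' i)
      rcases (hd.trans hd').eq_or_lt with e | e
      · have : a = B := le_antisymm hd (e ▸ hd')
        exact ⟨d, 0, le_rfl, zero_le_one, hod, by simpa using hd, by simp [a, ← this]⟩
      · have hp : 0 < b - a := sub_pos.2 e
        have key : (1 - (B - a) / (b - a)) * a + (B - a) / (b - a) * b = B := by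
          field_simp; ring
        refine ⟨d', (B - a) / (b - a), div_nonneg (by linarith) hp.le,
          (div_le_one hp).2 (by linarith), hod', key.le, ?_⟩
        change lam * ((1 - (B - a) / (b - a)) * a + (B - a) / (b - a) * b - B) = 0
        rw [key]; simp
  have hsum : ∀ (i : Fin N) (g : Fin K → ℝ),
      ∑ k, ((1 - t) * (if k = d i then 1 else 0) + t * (if k = d' i then 1 else 0)) * g k
        = (1 - t) * g (d i) + t * g (d' i) := by
    intro i g
    simp [add_mul, Finset.sum_add_distrib, mul_assoc, ← Finset.mul_sum]
  have hsum2 : ∀ (g : Fin N → Fin K → ℝ),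
      (N : ℝ)⁻¹ * ∑ i, ∑ k,
        ((1 - t) * (if k = d i then 1 else 0) + t * (if k = d' i then 1 else 0)) * g i k
        = (1 - t) * ((N : ℝ)⁻¹ * ∑ i, g i (d i)) + t * ((N : ℝ)⁻¹ * ∑ i, g i (d' i)) := by
    intro g
    simp only [hsum, Finset.sum_add_distrib, ← Finset.mul_sum]
    ring
  refine ⟨fun i k => (1 - t) * (if k = d i then 1 else 0) + t * (if k = d' i then 1 else 0),
    ⟨?_, ?_, ?_⟩, ?_⟩
  · intro i k
    have : 0 ≤ 1 - t := by linarith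
    positivity
  · intro i
    have := hsum i (fun _ => 1)
    simp only [mul_one] at this ⊢
    linarith
  · exact (hsum2 (fun _ => C)).le.trans hc
  · unfold ValLP
    rw [hsum2 Acc]
    have e1 := hod.G_eq hK B
    have e2 := hod'.G_eq hK B
    linear_combination (1 - t) * e1 + t * e2 - hs

lemma weak_lp {N K : ℕ} (hK : 0 < K)
    (C : Fin K → ℝ) (Acc : Fin N → Fin K → ℝ) (B : ℝ) (p : Fin N → Fin K → ℝ)
    (hp : FeasLP C B p) (lam : ℝ) (hl : 0 ≤ lam) : ValLP Acc p ≤ Gdual hK C Acc B lam := by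
  obtain ⟨h1, h2, h3⟩ := hp
  obtain ⟨d, hd⟩ := exists_optD hK C Acc lam
  rw [hd.G_eq hK B]
  unfold ValLP
  have key : ∑ i, ∑ k, p i k * Acc i k - lam * ∑ i, ∑ k, p i k * C k
      ≤ ∑ i, Acc i (d i) - lam * ∑ i, C (d i) := by
    simp only [Finset.mul_sum, ← Finset.sum_sub_distrib]
    refine Finset.sum_le_sum fun i _ => ?_
    calc ∑ k, (p i k * Acc i k - lam * (p i k * C k))
        = ∑ k, p i k * (Acc i k - lam * C k) := Finset.sum_congr rfl fun k _ => by ring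
      _ ≤ ∑ k, p i k * (Acc i (d i) - lam * C (d i)) :=
        Finset.sum_le_sum fun k _ => mul_le_mul_of_nonneg_left (hd i k) (h1 i k)
      _ = Acc i (d i) - lam * C (d i) := by rw [← Finset.sum_mul, h2, one_mul]
  have k2 := mul_le_mul_of_nonneg_left key (show (0:ℝ) ≤ (N : ℝ)⁻¹ by positivity)
  have k3 := mul_le_mul_of_nonneg_left h3 hl
  linarith

/-- Strong duality for the LP relaxation (Proposition 2, stochastic-policy form):
if `min_k C k ≤ B`, then the LP value `V̂_LP(B)` (supremum of expected accuracy over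
feasible stochastic policies) equals `min_{lam ≥ 0} G(lam)`, and both the supremum
and the minimum are attained. -/
theorem lp_strong_duality {N K : ℕ} (hN : 0 < N) (hK : 0 < K)
    (C : Fin K → ℝ) (Acc : Fin N → Fin K → ℝ)
    (hAcc : ∀ i k, 0 ≤ Acc i k ∧ Acc i k ≤ 1)
    (B : ℝ)
    (hB : Finset.univ.inf' ⟨⟨0, hK⟩, Finset.mem_univ _⟩ C ≤ B) :
    (∃ p : Fin N → Fin K → ℝ, FeasLP C B p ∧
      ValLP Acc p = sSup {v : ℝ | ∃ p : Fin N → Fin K → ℝ, FeasLP C B p ∧ v = ValLP Acc p}) ∧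
    (∃ lamStar : ℝ, 0 ≤ lamStar ∧
      (∀ lam : ℝ, 0 ≤ lam → Gdual hK C Acc B lamStar ≤ Gdual hK C Acc B lam) ∧
      Gdual hK C Acc B lamStar =
        sSup {v : ℝ | ∃ p : Fin N → Fin K → ℝ, FeasLP C B p ∧ v = ValLP Acc p}) := by
  obtain ⟨lam, h0, p, hp, he⟩ := core_lp hN hK C Acc hAcc B hB
  have hs : ValLP Acc p =
      sSup {v : ℝ | ∃ p : Fin N → Fin K → ℝ, FeasLP C B p ∧ v = ValLP Acc p} := by
    symm
    apply IsGreatest.csSup_eq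
    refine ⟨⟨p, hp, rfl⟩, ?_⟩
    rintro v ⟨q, hq, rfl⟩
    rw [← he]
    exact weak_lp hK C Acc B q hq lam h0
  refine ⟨⟨p, hp, hs⟩, lam, h0, ?_, he.trans hs⟩
  intro l hl
  rw [he]
  exact weak_lp hK C Acc B p hp l hl
end

section
/- (Near-feasibility, Theorem 3 part 1.) Suppose the oracle policy satisfies ∫ C(π⋆ x) dμ(x) ≤ B, and let ε = μ{x : π̂ x ≠ π⋆ x} for a measurable policy π̂. Then ∫ C(π̂ x) dμ(x) ≤ B + ε · (max_k C k − min_k C k). -/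
open MeasureTheory

/-- Near-feasibility (Theorem 3, part 1): if the oracle policy satisfies
`∫ C (π⋆ x) dμ ≤ B` and `ε = μ{x : π̂ x ≠ π⋆ x}` for a measurable policy `π̂`, then
`∫ C (π̂ x) dμ ≤ B + ε * (max_k C k - min_k C k)`. -/
theorem near_feasibility {X : Type*} [MeasurableSpace X]
    (mu : Measure X) [IsProbabilityMeasure mu]
    {K : ℕ} (hK : 0 < K) (C : Fin K → ℝ) (Acc : X → Fin K → ℝ)
    (hAcc : ∀ x k, 0 ≤ Acc x k ∧ Acc x k ≤ 1)
    (hAccMeas : ∀ k, Measurable fun x => Acc x k)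
    (lam : ℝ) (hlam : 0 ≤ lam)
    (polStar : X → Fin K) (hpolStarMeas : Measurable polStar)
    (hStar : ∀ x : X, Acc x (polStar x) - lam * C (polStar x) =
      Finset.univ.sup' ⟨⟨0, hK⟩, Finset.mem_univ _⟩ (fun k => Acc x k - lam * C k))
    (polHat : X → Fin K) (hpolHatMeas : Measurable polHat)
    (B : ℝ) (hOracleFeas : ∫ x, C (polStar x) ∂mu ≤ B) :
    ∫ x, C (polHat x) ∂mu ≤
      B + (mu {x : X | polHat x ≠ polStar x}).toReal *
        (Finset.univ.sup' ⟨⟨0, hK⟩, Finset.mem_univ _⟩ C -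
          Finset.univ.inf' ⟨⟨0, hK⟩, Finset.mem_univ _⟩ C) := by
  have hint : ∀ p : X → Fin K, Measurable p → Integrable (fun x => C (p x)) mu := by
    intro p hp
    refine Integrable.of_bound ((measurable_of_finite C).comp hp).aestronglyMeasurable
      (∑ k, ‖C k‖) (Filter.Eventually.of_forall fun x => ?_)
    exact Finset.single_le_sum (f := fun k => ‖C k‖) (fun k _ => norm_nonneg _)
      (Finset.mem_univ (p x))
  have hS : MeasurableSet {x : X | polHat x ≠ polStar x} :=
    (measurableSet_eq_fun hpolHatMeas hpolStarMeas).compl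
  set D : ℝ := Finset.univ.sup' ⟨⟨0, hK⟩, Finset.mem_univ _⟩ C -
          Finset.univ.inf' ⟨⟨0, hK⟩, Finset.mem_univ _⟩ C with hD
  have hI : Integrable ({x : X | polHat x ≠ polStar x}.indicator fun _ => D) mu :=
    (integrable_const D).indicator hS
  have key : ∫ x, C (polHat x) ∂mu ≤
      ∫ x, (C (polStar x) + {x : X | polHat x ≠ polStar x}.indicator (fun _ => D) x) ∂mu := by
    refine integral_mono (hint _ hpolHatMeas) ((hint _ hpolStarMeas).add hI) fun x => ?_
    by_cases h : polHat x = polStar x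
    · simp [h]
    · have h1 := Finset.le_sup' C (Finset.mem_univ (polHat x))
      have h2 := Finset.inf'_le C (Finset.mem_univ (polStar x))
      have h3 : {x : X | polHat x ≠ polStar x}.indicator (fun _ => D) x = D :=
        Set.indicator_of_mem (s := {x : X | polHat x ≠ polStar x}) h _
      simp only [h3]
      linarith
  rw [integral_add (hint _ hpolStarMeas) hI, integral_indicator_const D hS, smul_eq_mul] at key
  have : mu.real {x : X | polHat x ≠ polStar x} =
    (mu {x : X | polHat x ≠ polStar x}).toReal := rfl
  rw [this] at key
  linarith
end

section
/- (Near-optimality, Theorem 3 part 2, with the cost-deviation term made explicit.) Let λ ≥ 0, let π̂ be a measurable policy, set ε = μ{x : π̂ x ≠ π⋆ x} and B' = B + ε·(max_k C k − min_k C k), and let M̄ be a real number with M λ x ≤ M̄ for all x. Define V(B') as the supremum over measurable policies π with ∫ C(π x) dμ(x) ≤ B' of ∫ Acc x (π x) dμ(x). If ∫ C(π⋆ x) dμ(x) ≤ B, then V(B') − ∫ Acc x (π̂ x) dμ(x) ≤ M̄·ε + λ·(B' − ∫ C(π̂ x) dμ(x)). -/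
open MeasureTheory

/-- Near-optimality (Theorem 3, part 2, with the cost-deviation term explicit):
with `ε = μ{x : π̂ x ≠ π⋆ x}`, `B' = B + ε * (max_k C k - min_k C k)`, and `M̄` a
uniform bound on the worst-case per-instance gap, if `∫ C (π⋆ x) dμ ≤ B` then
`V(B') - ∫ Acc x (π̂ x) dμ ≤ M̄ * ε + lam * (B' - ∫ C (π̂ x) dμ)`, where `V(B')` is
the supremum of `∫ Acc x (π x) dμ` over measurable policies with
`∫ C (π x) dμ ≤ B'`. -/
theorem near_optimality {X : Type*} [MeasurableSpace X]
    (mu : Measure X) [IsProbabilityMeasure mu]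
    {K : ℕ} (hK : 0 < K) (C : Fin K → ℝ) (Acc : X → Fin K → ℝ)
    (hAcc : ∀ x k, 0 ≤ Acc x k ∧ Acc x k ≤ 1)
    (hAccMeas : ∀ k, Measurable fun x => Acc x k)
    (lam : ℝ) (hlam : 0 ≤ lam)
    (polStar : X → Fin K) (hpolStarMeas : Measurable polStar)
    (hStar : ∀ x : X, Acc x (polStar x) - lam * C (polStar x) =
      Finset.univ.sup' ⟨⟨0, hK⟩, Finset.mem_univ _⟩ (fun k => Acc x k - lam * C k))
    (polHat : X → Fin K) (hpolHatMeas : Measurable polHat)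
    (Mbar : ℝ)
    (hMbar : ∀ x : X,
      (Acc x (polStar x) - lam * C (polStar x)) -
        Finset.univ.inf' ⟨⟨0, hK⟩, Finset.mem_univ _⟩
          (fun k => Acc x k - lam * C k) ≤ Mbar)
    (B : ℝ) (hOracleFeas : ∫ x, C (polStar x) ∂mu ≤ B) :
    sSup {v : ℝ | ∃ pol : X → Fin K, Measurable pol ∧
        (∫ x, C (pol x) ∂mu ≤
          B + (mu {x : X | polHat x ≠ polStar x}).toReal *
            (Finset.univ.sup' ⟨⟨0, hK⟩, Finset.mem_univ _⟩ C -
              Finset.univ.inf' ⟨⟨0, hK⟩, Finset.mem_univ _⟩ C)) ∧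
        v = ∫ x, Acc x (pol x) ∂mu} -
      ∫ x, Acc x (polHat x) ∂mu ≤
    Mbar * (mu {x : X | polHat x ≠ polStar x}).toReal +
      lam * ((B + (mu {x : X | polHat x ≠ polStar x}).toReal *
          (Finset.univ.sup' ⟨⟨0, hK⟩, Finset.mem_univ _⟩ C -
            Finset.univ.inf' ⟨⟨0, hK⟩, Finset.mem_univ _⟩ C)) -
        ∫ x, C (polHat x) ∂mu) := by
  have hIC : ∀ pol : X → Fin K, Measurable pol → Integrable (fun x => C (pol x)) mu := by
    intro pol hp
    refine Integrable.of_bound (C := ∑ k, |C k|)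
      ((measurable_of_finite C).comp hp).aestronglyMeasurable ?_
    refine Filter.Eventually.of_forall fun x => ?_
    rw [Real.norm_eq_abs]
    exact Finset.single_le_sum (f := fun k => |C k|) (fun k _ => abs_nonneg _)
      (Finset.mem_univ (pol x))
  have hIA : ∀ pol : X → Fin K, Measurable pol → Integrable (fun x => Acc x (pol x)) mu := by
    intro pol hp
    have hm : Measurable (fun x => Acc x (pol x)) := by
      have h1 : Measurable (fun p : X × Fin K => Acc p.1 p.2) :=
        measurable_from_prod_countable_left hAccMeas
      exact h1.comp (measurable_id.prodMk hp)
    refine Integrable.of_bound (C := 1) hm.aestronglyMeasurable ?_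
    refine Filter.Eventually.of_forall fun x => ?_
    rw [Real.norm_eq_abs, abs_of_nonneg (hAcc _ _).1]
    exact (hAcc _ _).2
  have hJ : ∀ pol : X → Fin K, Measurable pol →
      ∫ x, (Acc x (pol x) - lam * C (pol x)) ∂mu =
        ∫ x, Acc x (pol x) ∂mu - lam * ∫ x, C (pol x) ∂mu := by
    intro pol hp
    rw [integral_sub (hIA pol hp) ((hIC pol hp).const_mul lam), integral_const_mul]
  have hIJ : ∀ pol : X → Fin K, Measurable pol →
      Integrable (fun x => Acc x (pol x) - lam * C (pol x)) mu := fun pol hp =>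
    (hIA pol hp).sub ((hIC pol hp).const_mul lam)
  have hS : MeasurableSet {x : X | polHat x ≠ polStar x} :=
    (measurableSet_eq_fun hpolHatMeas hpolStarMeas).compl
  have hgap : ∫ x, (Acc x (polStar x) - lam * C (polStar x)) ∂mu -
      ∫ x, (Acc x (polHat x) - lam * C (polHat x)) ∂mu ≤
      Mbar * (mu {x : X | polHat x ≠ polStar x}).toReal := by
    rw [← integral_sub (hIJ _ hpolStarMeas) (hIJ _ hpolHatMeas)]
    have h2 : ∫ x, ({x : X | polHat x ≠ polStar x}.indicator (fun _ => Mbar) x) ∂mu =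
        Mbar * (mu {x : X | polHat x ≠ polStar x}).toReal := by
      rw [integral_indicator_const _ hS, smul_eq_mul, mul_comm]; rfl
    rw [← h2]
    refine integral_mono ((hIJ _ hpolStarMeas).sub (hIJ _ hpolHatMeas))
      ((integrable_const Mbar).indicator hS) fun x => ?_
    by_cases hx : polHat x = polStar x
    · simp [hx]
    · rw [Set.indicator_of_mem (by exact hx)]
      have h3 := hMbar x
      have h4 := Finset.inf'_le (fun k => Acc x k - lam * C k) (Finset.mem_univ (polHat x))
      simp only at h4 ⊢
      linarith
  have hrange : 0 ≤ (mu {x : X | polHat x ≠ polStar x}).toReal *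
      (Finset.univ.sup' ⟨⟨0, hK⟩, Finset.mem_univ _⟩ C -
        Finset.univ.inf' ⟨⟨0, hK⟩, Finset.mem_univ _⟩ C) := by
    refine mul_nonneg ENNReal.toReal_nonneg (sub_nonneg.2 ?_)
    exact (Finset.inf'_le C (Finset.mem_univ ⟨0, hK⟩)).trans
      (Finset.le_sup' C (Finset.mem_univ ⟨0, hK⟩))
  rw [sub_le_iff_le_add]
  refine csSup_le ⟨_, polStar, hpolStarMeas, by linarith, rfl⟩ ?_
  rintro v ⟨pol, hp, hfeas, rfl⟩
  have hopt : ∫ x, (Acc x (pol x) - lam * C (pol x)) ∂mu ≤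
      ∫ x, (Acc x (polStar x) - lam * C (polStar x)) ∂mu := by
    refine integral_mono (hIJ _ hp) (hIJ _ hpolStarMeas) fun x => ?_
    simp only
    rw [hStar x]
    exact Finset.le_sup' (fun k => Acc x k - lam * C k) (Finset.mem_univ (pol x))
  have h5 := mul_le_mul_of_nonneg_left hfeas hlam
  have h6 := hJ _ hp
  have h7 := hJ _ hpolHatMeas
  rw [mul_sub]
  linarith
end
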